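/- Let n ≥ 0 be an integer, ε a real number, I an interval on which 1 + εx ≠ 0, and let y be an (n+1)-times differentiable real function on an interval containing {x/(1+εx) : x ∈ I}. Then for every x ∈ I, the (n+1)-th derivative of the function x ↦ (1+εx)^n · y(x/(1+εx)) equals (1+εx)^{−(n+2)} · y^{(n+1)}(x/(1+εx)). -/

import Mathlib

open Filter Topology

/-- `m`-fold differentiability in a neighbourhood of `x`. -/
def NearDiff : ℕ → (ℝ → ℝ) → ℝ → Prop
  | 0, _, _ => True
  | m + 1, f, x => (∀ᶠ z in 𝓝 x, DifferentiableAt ℝ f z) ∧ NearDiff m (deriv f) x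

theorem NearDiff.iff_iter (m : ℕ) : ∀ (f : ℝ → ℝ) (x : ℝ), NearDiff m f x ↔
    ∀ k < m, ∀ᶠ z in 𝓝 x, DifferentiableAt ℝ (iteratedDeriv k f) z := by
  induction m with
  | zero => intro f x; simp [NearDiff]
  | succ m ih =>
    intro f x
    rw [NearDiff, ih]
    constructor
    · rintro ⟨h0, h⟩ k hk
      cases k with
      | zero => simpa using h0
      | succ k => rw [iteratedDeriv_succ']; exact h k (by omega)
    · intro h
      refine ⟨by simpa using h 0 (by omega), fun k hk => ?_⟩
      have := h (k + 1) (by omega)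
      rwa [iteratedDeriv_succ'] at this

theorem NearDiff.congr {m : ℕ} : ∀ {f g : ℝ → ℝ} {x : ℝ}, NearDiff m f x → f =ᶠ[𝓝 x] g →
    NearDiff m g x := by
  induction m with
  | zero => intros; trivial
  | succ m ih =>
    rintro f g x ⟨h0, h⟩ e
    refine ⟨?_, ih h e.deriv⟩
    filter_upwards [h0, e.eventuallyEq_nhds] with z hz ez
    exact hz.congr_of_eventuallyEq ez.symm

theorem NearDiff.pred {m : ℕ} : ∀ {f : ℝ → ℝ} {x : ℝ}, NearDiff (m + 1) f x →
    NearDiff m f x := by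
  induction m with
  | zero => intros; trivial
  | succ m ih =>
    rintro f x ⟨h0, h⟩
    exact ⟨h0, ih h⟩

theorem NearDiff.add {m : ℕ} : ∀ {f g : ℝ → ℝ} {x : ℝ}, NearDiff m f x → NearDiff m g x →
    NearDiff m (fun z => f z + g z) x := by
  induction m with
  | zero => intros; trivial
  | succ m ih =>
    rintro f g x ⟨f0, hf⟩ ⟨g0, hg⟩
    refine ⟨?_, (ih hf hg).congr ?_⟩
    · filter_upwards [f0, g0] with z a b using a.fun_add b
    · filter_upwards [f0, g0] with z a b
      exact (a.hasDerivAt.fun_add b.hasDerivAt).deriv.symm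

theorem NearDiff.mul {m : ℕ} : ∀ {f g : ℝ → ℝ} {x : ℝ}, NearDiff m f x → NearDiff m g x →
    NearDiff m (fun z => f z * g z) x := by
  induction m with
  | zero => intros; trivial
  | succ m ih =>
    intro f g x hf' hg'
    obtain ⟨f0, hf⟩ := id hf'
    obtain ⟨g0, hg⟩ := id hg'
    refine ⟨?_, ((ih hf hg'.pred).add (ih hf'.pred hg)).congr ?_⟩
    · filter_upwards [f0, g0] with z a b using a.fun_mul b
    · filter_upwards [f0, g0] with z a b
      exact (a.hasDerivAt.fun_mul b.hasDerivAt).deriv.symm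

theorem NearDiff.of_analytic {m : ℕ} : ∀ {f : ℝ → ℝ} {x : ℝ}, AnalyticAt ℝ f x →
    NearDiff m f x := by
  induction m with
  | zero => intros; trivial
  | succ m ih =>
    intro f x h
    refine ⟨?_, ih h.deriv⟩
    filter_upwards [h.eventually_analyticAt] with z hz using hz.differentiableAt

theorem NearDiff.comp {m : ℕ} : ∀ {f g : ℝ → ℝ} {x : ℝ}, NearDiff m f (g x) →
    AnalyticAt ℝ g x → NearDiff m (fun z => f (g z)) x := by
  induction m with
  | zero => intros; trivial
  | succ m ih =>
    rintro f g x ⟨f0, hf⟩ hg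
    have f1 := hg.continuousAt.eventually f0
    refine ⟨?_, ((ih hf hg).mul (NearDiff.of_analytic hg.deriv)).congr ?_⟩
    · filter_upwards [f1, hg.eventually_analyticAt] with z a b
      exact a.fun_comp' z b.differentiableAt
    · filter_upwards [f1, hg.eventually_analyticAt] with z a b
      exact (a.hasDerivAt.comp z b.differentiableAt.hasDerivAt).deriv.symm

/-- The transformation of weight `m`. -/
noncomputable def trans7 (ε : ℝ) (m : ℤ) (y : ℝ → ℝ) (x : ℝ) : ℝ :=
  (1 + ε * x) ^ m * y (x / (1 + ε * x))

theorem analytic_u (ε x : ℝ) : AnalyticAt ℝ (fun z : ℝ => 1 + ε * z) x := by fun_prop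

theorem analytic_g {ε x : ℝ} (h : 1 + ε * x ≠ 0) :
    AnalyticAt ℝ (fun z : ℝ => z / (1 + ε * z)) x :=
  analyticAt_id.fun_div (analytic_u ε x) h

theorem NearDiff.trans7 {N : ℕ} {ε x : ℝ} {m : ℤ} {y : ℝ → ℝ} (h : 1 + ε * x ≠ 0)
    (hy : NearDiff N y (x / (1 + ε * x))) : NearDiff N (trans7 ε m y) x := by
  have h1 : AnalyticAt ℝ (fun z : ℝ => (1 + ε * z) ^ m) x := (analytic_u ε x).fun_zpow h
  exact (NearDiff.of_analytic h1).mul (NearDiff.comp (g := fun z => z / (1 + ε * z)) hy (analytic_g h))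

theorem hasDerivAt_trans7 {ε x : ℝ} {m : ℤ} {y : ℝ → ℝ} (h : 1 + ε * x ≠ 0)
    (hy : DifferentiableAt ℝ y (x / (1 + ε * x))) :
    HasDerivAt (trans7 ε m y)
      (m * ε * trans7 ε (m - 1) y x + trans7 ε (m - 2) (deriv y) x) x := by
  have hu : HasDerivAt (fun z : ℝ => 1 + ε * z) ε x := by
    simpa using ((hasDerivAt_id x).const_mul ε).const_add 1
  have hg := (hasDerivAt_id x).fun_div hu h
  have hp := (hasDerivAt_zpow m (1 + ε * x) (Or.inl h)).comp x hu
  have hc := HasDerivAt.comp x (h₂ := y) (h := fun z : ℝ => z / (1 + ε * z)) hy.hasDerivAt hg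
  have := hp.fun_mul hc
  refine this.congr_deriv ?_
  simp only [_root_.trans7, Function.comp, id]
  rw [zpow_sub₀ h m 2]
  field_simp
  norm_cast
  ring

theorem leibniz_lin (ε : ℝ) (N : ℕ) : ∀ (f : ℝ → ℝ) (x : ℝ), NearDiff N f x →
    DifferentiableAt ℝ (iteratedDeriv N f) x →
    iteratedDeriv (N + 1) (fun z => (1 + ε * z) * f z) x =
      (1 + ε * x) * iteratedDeriv (N + 1) f x + (N + 1) * ε * iteratedDeriv N f x := by
  induction N with
  | zero =>
    intro f x _ hd
    have hu : HasDerivAt (fun z : ℝ => 1 + ε * z) ε x := by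
      simpa using ((hasDerivAt_id x).const_mul ε).const_add 1
    simp only [iteratedDeriv_zero] at hd
    simp only [zero_add, iteratedDeriv_one, iteratedDeriv_zero]
    rw [(hu.fun_mul hd.hasDerivAt).deriv]
    push_cast; ring
  | succ N ih =>
    intro f x hf hd
    have hu : HasDerivAt (fun z : ℝ => 1 + ε * z) ε x := by
      simpa using ((hasDerivAt_id x).const_mul ε).const_add 1
    have hN := (NearDiff.iff_iter _ _ _).1 hf
    have e : iteratedDeriv (N + 1) (fun z => (1 + ε * z) * f z) =ᶠ[𝓝 x] fun z =>
        (1 + ε * z) * iteratedDeriv (N + 1) f z + (N + 1) * ε * iteratedDeriv N f z := by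
      have h1 : ∀ᶠ z in 𝓝 x, NearDiff N f z := by
        have := (Filter.eventually_all_finset (Finset.range (N + 1))).2
          (fun k hk => (hN k (Finset.mem_range.1 hk)).eventually_nhds)
        filter_upwards [this] with z hz
        exact (NearDiff.iff_iter _ _ _).2 fun k hk => hz k (Finset.mem_range.2 (by omega))
      filter_upwards [h1, hN N (by omega)] with z a b using ih f z a b
    have d1 := (hN N (by omega)).self_of_nhds
    rw [iteratedDeriv_succ, e.deriv_eq]
    have := (hu.fun_mul hd.hasDerivAt).fun_add (d1.hasDerivAt.const_mul (((N : ℝ) + 1) * ε))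
    rw [this.deriv, ← iteratedDeriv_succ, ← iteratedDeriv_succ]
    push_cast; ring

theorem NearDiff.eventually {m : ℕ} {f : ℝ → ℝ} {x : ℝ} (h : NearDiff m f x) :
    ∀ᶠ z in 𝓝 x, NearDiff m f z := by
  have hN := (NearDiff.iff_iter _ _ _).1 h
  have := (Filter.eventually_all_finset (Finset.range m)).2
    (fun k hk => (hN k (Finset.mem_range.1 hk)).eventually_nhds)
  filter_upwards [this] with z hz
  exact (NearDiff.iff_iter _ _ _).2 fun k hk => hz k (Finset.mem_range.2 hk)

theorem main_smooth (ε : ℝ) (y : ℝ → ℝ) (N : ℕ) : ∀ x : ℝ, 1 + ε * x ≠ 0 →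
    NearDiff N y (x / (1 + ε * x)) →
    DifferentiableAt ℝ (iteratedDeriv N y) (x / (1 + ε * x)) →
    iteratedDeriv (N + 1) (trans7 ε N y) x = trans7 ε (-(N + 2)) (iteratedDeriv (N + 1) y) x := by
  have step : ∀ (N : ℕ) (x : ℝ), 1 + ε * x ≠ 0 → NearDiff N y (x / (1 + ε * x)) →
      DifferentiableAt ℝ (iteratedDeriv N y) (x / (1 + ε * x)) →
      iteratedDeriv N (trans7 ε (N - 1) y) =ᶠ[𝓝 x] trans7 ε (-(N + 1)) (iteratedDeriv N y) →
      iteratedDeriv (N + 1) (trans7 ε N y) x =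
        trans7 ε (-(N + 2)) (iteratedDeriv (N + 1) y) x := by
    intro N x h hN hd e
    have hT := hasDerivAt_trans7 (m := -(N + 1)) h hd
    have e0 : trans7 ε N y =ᶠ[𝓝 x] fun z => (1 + ε * z) * trans7 ε (N - 1) y z := by
      filter_upwards [(analytic_u ε x).continuousAt.eventually_ne h] with z hz
      simp only [trans7]
      rw [zpow_sub_one₀ hz]
      field_simp
    rw [e0.iteratedDeriv_eq, leibniz_lin ε N _ x (NearDiff.trans7 h hN)
      (hT.differentiableAt.congr_of_eventuallyEq e), iteratedDeriv_succ, e.deriv_eq, hT.deriv,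
      e.self_of_nhds, ← iteratedDeriv_succ]
    simp only [trans7]
    have a1 : (1 + ε * x) ^ (-((N : ℤ) + 1)) = (1 + ε * x) ^ (-((N : ℤ) + 2)) * (1 + ε * x) := by
      rw [← zpow_add_one₀ h]; ring_nf
    have a2 : (1 + ε * x) ^ (-((N : ℤ) + 1) - 1) = (1 + ε * x) ^ (-((N : ℤ) + 2)) := by
      ring_nf
    have a3 : (1 + ε * x) ^ (-((N : ℤ) + 2)) =
        (1 + ε * x) ^ (-((N : ℤ) + 1) - 2) * (1 + ε * x) := by
      rw [← zpow_add_one₀ h]; ring_nf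
    rw [a1, a2, a3]
    push_cast; ring
  induction N with
  | zero =>
    intro x h hN hd
    refine step 0 x h hN hd (Eventually.of_forall fun z => ?_)
    simp
  | succ N ih =>
    intro x h hN hd
    refine step (N + 1) x h hN hd ?_
    have c := (analytic_g h).continuousAt.eventually hN.eventually
    filter_upwards [c, (analytic_u ε x).continuousAt.eventually_ne h] with z a b
    have := ih z b a.pred (((NearDiff.iff_iter _ _ _).1 a) N (by omega)).self_of_nhds
    convert this using 2
    · push_cast; congr 1; ring
    · push_cast; ring

theorem punctured_ne {f : ℝ → ℝ} {a : ℝ} (h : ∀ᶠ x in 𝓝[≠] a, deriv f x ≠ 0) :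
    ∀ᶠ x in 𝓝[≠] a, f x ≠ 0 := by
  rw [← nhdsLT_sup_nhdsGT, eventually_sup] at h ⊢
  obtain ⟨hl, hr⟩ := h
  constructor
  · obtain ⟨b, hb, hs⟩ := (mem_nhdsLT_iff_exists_Ioo_subset).1 hl
    by_cases hz : ∃ p ∈ Set.Ioo b a, f p = 0
    · obtain ⟨p, hp, hp0⟩ := hz
      filter_upwards [Ioo_mem_nhdsLT hp.2] with q hq hq0
      obtain ⟨c, hc, hc0⟩ := exists_deriv_eq_zero hq.1 (f := f) (fun w hw =>
        (differentiableAt_of_deriv_ne_zero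
          (hs ⟨hp.1.trans_le hw.1, hw.2.trans_lt hq.2⟩)).continuousAt.continuousWithinAt)
        (hp0.trans hq0.symm)
      exact hs ⟨hp.1.trans hc.1, hc.2.trans hq.2⟩ hc0
    · push Not at hz
      filter_upwards [Ioo_mem_nhdsLT hb] with q hq using hz q hq
  · obtain ⟨b, hb, hs⟩ := (mem_nhdsGT_iff_exists_Ioo_subset).1 hr
    by_cases hz : ∃ p ∈ Set.Ioo a b, f p = 0
    · obtain ⟨p, hp, hp0⟩ := hz
      filter_upwards [Ioo_mem_nhdsGT hp.1] with q hq hq0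
      obtain ⟨c, hc, hc0⟩ := exists_deriv_eq_zero hq.2 (f := f) (fun w hw =>
        (differentiableAt_of_deriv_ne_zero
          (hs ⟨hq.1.trans_le hw.1, hw.2.trans_lt hp.2⟩)).continuousAt.continuousWithinAt)
        (hq0.trans hp0.symm)
      exact hs ⟨hq.1.trans hc.1, hc.2.trans hp.2⟩ hc0
    · push Not at hz
      filter_upwards [Ioo_mem_nhdsGT hb] with q hq using hz q hq

theorem punctured_nearDiff {f : ℝ → ℝ} {a : ℝ} {n : ℕ} (h : iteratedDeriv (n + 1) f a ≠ 0) :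
    ∀ᶠ x in 𝓝[≠] a, NearDiff n f x := by
  have h0 : ∀ᶠ x in 𝓝[≠] a, iteratedDeriv n f x ≠ 0 := by
    rw [iteratedDeriv_succ] at h
    exact (differentiableAt_of_deriv_ne_zero h).hasDerivAt.eventually_ne h
  have h1 : ∀ j ≤ n, ∀ᶠ x in 𝓝[≠] a, iteratedDeriv (n - j) f x ≠ 0 := by
    intro j
    induction j with
    | zero => intro _; simpa using h0
    | succ j ih =>
      intro hj
      refine punctured_ne ?_
      rw [← iteratedDeriv_succ, show n - (j + 1) + 1 = n - j by omega]
      exact ih (by omega)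
  have h2 : ∀ k ∈ Finset.range n, ∀ᶠ x in 𝓝[≠] a, ∀ᶠ z in 𝓝 x,
      DifferentiableAt ℝ (iteratedDeriv k f) z := by
    intro k hk
    have hk := Finset.mem_range.1 hk
    have := h1 (n - (k + 1)) (by omega)
    rw [show n - (n - (k + 1)) = k + 1 by omega, ← eventually_eventually_nhdsWithin] at this
    filter_upwards [this, self_mem_nhdsWithin] with x hx hxa
    rw [(isOpen_compl_singleton).nhdsWithin_eq hxa] at hx
    filter_upwards [hx] with z hz
    rw [iteratedDeriv_succ] at hz
    exact differentiableAt_of_deriv_ne_zero hz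
  filter_upwards [(Filter.eventually_all_finset _).2 h2] with x hx
  exact (NearDiff.iff_iter _ _ _).2 fun k hk => hx k (Finset.mem_range.2 hk)

theorem nearDiff_fill {f : ℝ → ℝ} {a : ℝ} {n : ℕ} (h : ∀ᶠ x in 𝓝[≠] a, NearDiff n f x)
    (hd : ∀ k < n, DifferentiableAt ℝ (iteratedDeriv k f) a) : NearDiff n f a := by
  refine (NearDiff.iff_iter _ _ _).2 fun k hk => ?_
  rw [eventually_nhdsWithin_iff] at h
  filter_upwards [h] with z hz
  by_cases e : z = a
  · rw [e]; exact hd k hk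
  · exact ((NearDiff.iff_iter _ _ _).1 (hz e) k hk).self_of_nhds

theorem one_sub_aux {a s : ℝ} (h : 1 + a * s ≠ 0) :
    1 + -a * (s / (1 + a * s)) = 1 / (1 + a * s) := by
  field_simp; ring

theorem div_div_one_div {d s : ℝ} (h : d ≠ 0) : s / d / (1 / d) = s := by
  field_simp

/-- Let `n ≥ 0`, let `I` be an interval on which `1 + ε*x ≠ 0`, and let `y`
be `(n+1)`-times differentiable on an interval `J` containing `{x/(1+ε*x) : x ∈ I}`.
Then for every `x ∈ I`, the `(n+1)`-th derivative of `x ↦ (1+ε*x)^n * y (x/(1+ε*x))`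
equals `(1+ε*x)^(-(n+2)) * y⁽ⁿ⁺¹⁾ (x/(1+ε*x))`. -/
theorem stmt7 (n : ℕ) (ε : ℝ) (I : Set ℝ) (hI : I.OrdConnected)
    (hne : ∀ x ∈ I, 1 + ε * x ≠ 0)
    (y : ℝ → ℝ) (J : Set ℝ) (hJ : J.OrdConnected)
    (hmap : ∀ x ∈ I, x / (1 + ε * x) ∈ J)
    (hy : ∀ k ≤ n, ∀ t ∈ J, DifferentiableAt ℝ (iteratedDeriv k y) t) :
    ∀ x ∈ I,
      iteratedDeriv (n + 1) (fun x : ℝ => (1 + ε * x) ^ n * y (x / (1 + ε * x))) x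
        = (1 + ε * x) ^ (-((n : ℤ) + 2)) * iteratedDeriv (n + 1) y (x / (1 + ε * x)) := by
  intro x hx
  have h := hne x hx
  have hd := fun k hk => hy k hk _ (hmap x hx)
  have key : NearDiff n y (x / (1 + ε * x)) →
      iteratedDeriv (n + 1) (fun x : ℝ => (1 + ε * x) ^ n * y (x / (1 + ε * x))) x
        = (1 + ε * x) ^ (-((n : ℤ) + 2)) * iteratedDeriv (n + 1) y (x / (1 + ε * x)) := by
    intro hn
    have := main_smooth ε y n x h hn (hd n le_rfl)
    have e : (fun x : ℝ => (1 + ε * x) ^ n * y (x / (1 + ε * x))) = trans7 ε n y := by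
      funext z; simp only [trans7, zpow_natCast]
    rw [e, this, trans7]
  by_cases c1 : iteratedDeriv (n + 1) y (x / (1 + ε * x)) = 0
  swap
  · exact key (nearDiff_fill (punctured_nearDiff c1) fun k hk => hd k hk.le)
  by_cases c2 : iteratedDeriv (n + 1)
      (fun x : ℝ => (1 + ε * x) ^ n * y (x / (1 + ε * x))) x = 0
  · rw [c1, c2, mul_zero]
  refine key (nearDiff_fill ?_ fun k hk => hd k hk.le)
  have hF := punctured_nearDiff c2
  set F : ℝ → ℝ := fun x : ℝ => (1 + ε * x) ^ n * y (x / (1 + ε * x)) with hFdef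
  set t := x / (1 + ε * x) with ht
  have hs : 1 + -ε * t = 1 / (1 + ε * x) := one_sub_aux h
  have hs0 : 1 + -ε * t ≠ 0 := by rw [hs]; exact one_div_ne_zero h
  have hback : t / (1 + -ε * t) = x := by rw [hs, ht]; exact div_div_one_div h
  have hne' := (analytic_u (-ε) t).continuousAt.eventually_ne hs0
  have hcont := (analytic_g hs0).continuousAt
  have inv : ∀ s : ℝ, 1 + -ε * s ≠ 0 → trans7 (-ε) n F s = y s := by
    intro s hs
    have e1 : 1 + ε * (s / (1 + -ε * s)) = 1 / (1 + -ε * s) := by simpa using one_sub_aux hs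
    have e2 : s / (1 + -ε * s) / (1 + ε * (s / (1 + -ε * s))) = s := by rw [e1]; exact div_div_one_div hs
    simp only [trans7, hFdef]
    rw [e2, e1, zpow_natCast, ← mul_assoc, ← mul_pow, mul_one_div_cancel hs, one_pow, one_mul]
  rw [eventually_nhdsWithin_iff] at hF ⊢
  rw [ContinuousAt, hback] at hcont
  filter_upwards [hcont.eventually hF, hne'.eventually_nhds] with s a b hst
  have b0 := b.self_of_nhds
  have : s / (1 + -ε * s) ≠ x := by
    intro e
    apply hst
    have e1 : 1 + ε * x = 1 / (1 + -ε * s) := by rw [← e]; simpa using one_sub_aux b0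
    rw [Set.mem_singleton_iff, ht, e1, ← e]; exact (div_div_one_div b0).symm
  exact (NearDiff.trans7 (m := n) b0 (a this)).congr (b.mono fun z hz => inv z hz)
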